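/- arXiv:1301.4185 — 3 statements merged into one kernel-verified Lean document; each statement's English description precedes it below -/
import Mathlib

section
/- Let p be a probability distribution on ℤ with finite entropy H(p) = c and let x = ‖p‖_∞. Then H(p⋆p) − c ≥ ((1−x)²/(8 ln 2)) · ((1−x) ∨ (4x−2)⁺)². -/
/-- `p` is a probability distribution on `ℤ`. -/
def IsPMF (p : ℤ → ℝ) : Prop := (∀ k, 0 ≤ p k) ∧ HasSum p 1

/-- Convolution of two distributions on `ℤ`. -/
noncomputable def conv (p q : ℤ → ℝ) : ℤ → ℝ := fun k => ∑' j, p j * q (k - j)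

/-- Shannon entropy (in bits) of a distribution on `ℤ`. -/
noncomputable def entH (p : ℤ → ℝ) : ℝ := ∑' k, -(p k * Real.logb 2 (p k))

open Real Filter Topology

/-- The rearrangement `(k, j) ↦ (k - j, j)`. -/
def shearE : ℤ × ℤ ≃ ℤ × ℤ where
  toFun z := (z.1 - z.2, z.2)
  invFun z := (z.1 + z.2, z.2)
  left_inv z := by simp
  right_inv z := by simp

/-- The map `(j, k) ↦ (k - j, j)`. -/
def shearF : ℤ × ℤ ≃ ℤ × ℤ where
  toFun z := (z.2 - z.1, z.1)
  invFun z := (z.2, z.1 + z.2)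
  left_inv z := by simp
  right_inv z := by simp

lemma log_lower {u : ℝ} (hu : 0 < u) : (u - 1) * (5 * u + 1) / (2 * u * (u + 2)) ≤ log u := by
  let f : ℝ → ℝ := fun u => log u - (u - 1) * (5 * u + 1) / (2 * u * (u + 2))
  have hd : ∀ v : ℝ, 0 < v → HasDerivAt f ((v - 1) ^ 3 / (v ^ 2 * (v + 2) ^ 2)) v := by
    intro v hv
    have h1 : HasDerivAt (fun u : ℝ => (u - 1) * (5 * u + 1)) (1 * (5 * v + 1) + (v - 1) * (5 * 1)) v := by
      exact ((hasDerivAt_id v).sub_const 1).mul (((hasDerivAt_id v).const_mul 5).add_const 1)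
    have h2 : HasDerivAt (fun u : ℝ => 2 * u * (u + 2)) ((2 * 1) * (v + 2) + (2 * v) * 1) v := by
      exact ((hasDerivAt_id v).const_mul 2).mul ((hasDerivAt_id v).add_const 2)
    have h3 := (hasDerivAt_log hv.ne').sub (h1.div h2 (by positivity))
    have h4 : (v - 1) ^ 3 / (v ^ 2 * (v + 2) ^ 2) = v⁻¹ - ((1 * (5 * v + 1) + (v - 1) * (5 * 1)) *
        (2 * v * (v + 2)) - (v - 1) * (5 * v + 1) * ((2 * 1) * (v + 2) + (2 * v) * 1)) /
        (2 * v * (v + 2)) ^ 2 := by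
      field_simp
      ring
    rw [h4]
    exact h3
  have hf1 : f 1 = 0 := by simp [f]
  have hcont : ∀ s : Set ℝ, s ⊆ Set.Ioi 0 → ContinuousOn f s := fun s hs v hv =>
    (hd v (hs hv)).continuousAt.continuousWithinAt
  have key : 0 ≤ f u := by
    rcases le_total 1 u with h | h
    · have hm : MonotoneOn f (Set.Ici 1) := by
        apply monotoneOn_of_deriv_nonneg (convex_Ici 1)
        · exact hcont _ (fun v hv => Set.mem_Ioi.mpr (lt_of_lt_of_le one_pos (Set.mem_Ici.mp hv)))
        · intro v hv
          rw [interior_Ici] at hv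
          exact (hd v (lt_trans one_pos hv)).differentiableAt.differentiableWithinAt
        · intro v hv
          rw [interior_Ici] at hv
          rw [(hd v (lt_trans one_pos hv)).deriv]
          have : 0 ≤ v - 1 := by linarith [Set.mem_Ioi.mp hv]
          positivity
      rw [← hf1]
      exact hm (Set.mem_Ici.mpr le_rfl) h h
    · have hm : AntitoneOn f (Set.Ioc 0 1) := by
        apply antitoneOn_of_deriv_nonpos (convex_Ioc 0 1)
        · exact hcont _ (fun v hv => hv.1)
        · intro v hv
          rw [interior_Ioc] at hv
          exact (hd v hv.1).differentiableAt.differentiableWithinAt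
        · intro v hv
          rw [interior_Ioc] at hv
          rw [(hd v hv.1).deriv]
          have : v - 1 ≤ 0 := by linarith [hv.2]
          apply div_nonpos_of_nonpos_of_nonneg _ (by positivity)
          have h3 : (v - 1) ^ 3 = (v - 1) * (v - 1) ^ 2 := by ring
          rw [h3]
          exact mul_nonpos_of_nonpos_of_nonneg this (sq_nonneg _)
      rw [← hf1]
      exact hm ⟨hu, h⟩ ⟨one_pos, le_rfl⟩ h
  simp only [f] at key
  linarith

/-- Pointwise Pinsker inequality in linearised form. -/
lemma point_pinsker {a b t g : ℝ} (ha : 0 ≤ a) (hb : 0 < b) (hg : |g| ≤ 1) :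
    t * (g * a - g * b) - t ^ 2 * (a + 2 * b) / 6 ≤ a * log a - a * log b - a + b := by
  have h1 : 3 * (a - b) ^ 2 / (2 * (a + 2 * b)) ≤ a * log a - a * log b - a + b := by
    rcases ha.eq_or_lt with h | h
    · subst h
      have : 3 * (0 - b) ^ 2 / (2 * (0 + 2 * b)) = 3 / 4 * b := by field_simp; ring
      rw [this]; simp; linarith
    · have h2 := log_lower (div_pos h hb)
      rw [log_div h.ne' hb.ne'] at h2
      have h3 := mul_le_mul_of_nonneg_left h2 ha
      have : a * ((a / b - 1) * (5 * (a / b) + 1) / (2 * (a / b) * (a / b + 2))) =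
          3 * (a - b) ^ 2 / (2 * (a + 2 * b)) + a - b := by
        field_simp
        ring
      rw [this] at h3
      linarith
  refine le_trans ?_ h1
  have hs : 0 < a + 2 * b := by positivity
  have hg2 : g ^ 2 ≤ 1 := by
    rw [← sq_abs]; exact pow_le_one₀ (abs_nonneg g) hg
  rw [le_div_iff₀ (by positivity)]
  nlinarith [sq_nonneg (3 * g * (a - b) - t * (a + 2 * b)), sq_nonneg (a - b),
    mul_nonneg (sub_nonneg.mpr hg2) (sq_nonneg (a - b))]

lemma hasSum_of_eq {ι : Type*} {f g : ι → ℝ} {a : ℝ} (e : ∀ i, g i = f i) (h : HasSum f a) :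
    HasSum g a := by
  have : g = f := funext e
  rwa [this]

lemma prodSum {f g : ℤ → ℝ} {a b : ℝ} (hf : HasSum f a) (hg : HasSum g b) :
    HasSum (fun z : ℤ × ℤ => f z.1 * g z.2) (a * b) := by
  have h1 : Summable (fun z => ‖f z‖) := hf.summable.norm
  have h2 : Summable (fun z => ‖g z‖) := hg.summable.norm
  have h3 : Summable (fun z : ℤ × ℤ => f z.1 * g z.2) := summable_mul_of_summable_norm h1 h2
  exact HasSum.mul hf hg h3

section
variable {p : ℤ → ℝ}

lemma p_le_one (hp : IsPMF p) (k : ℤ) : p k ≤ 1 := le_hasSum hp.2 k fun j _ => hp.1 j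

lemma hasSum_w (hp : IsPMF p) : HasSum (fun z : ℤ × ℤ => p z.1 * p z.2) 1 := by
  have h := hp.2.mul hp.2 (hp.2.summable.mul_of_nonneg hp.2.summable hp.1 hp.1)
  simpa using h

lemma summable_conv (hp : IsPMF p) (k : ℤ) : Summable (fun j => p j * p (k - j)) :=
  Summable.of_nonneg_of_le (fun j => mul_nonneg (hp.1 _) (hp.1 _))
    (fun j => mul_le_of_le_one_right (hp.1 _) (p_le_one hp _)) hp.2.summable

lemma conv_nonneg (hp : IsPMF p) (k : ℤ) : 0 ≤ conv p p k :=
  tsum_nonneg fun j => mul_nonneg (hp.1 _) (hp.1 _)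

lemma le_conv (hp : IsPMF p) (i j : ℤ) : p i * p j ≤ conv p p (i + j) := by
  have h := (summable_conv hp (i + j)).le_tsum i (fun l _ => mul_nonneg (hp.1 _) (hp.1 _))
  simpa [conv] using h

/-- Push-forward along addition. -/
lemma fib (hp : IsPMF p) {f : ℤ → ℝ} {a : ℝ}
    (h : HasSum (fun z : ℤ × ℤ => p z.1 * p z.2 * f (z.1 + z.2)) a) :
    HasSum (fun k => conv p p k * f k) a := by
  have h1 := (shearE.hasSum_iff (f := fun z : ℤ × ℤ => p z.1 * p z.2 * f (z.1 + z.2))).mpr h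
  refine h1.prod_fiberwise fun k => ?_
  have h2 := (summable_conv hp k).hasSum.mul_right (f k)
  refine hasSum_of_eq ?_ (h2)
  intro j
  simp only [shearE, Equiv.coe_fn_mk, Function.comp, sub_add_cancel]
  ring

lemma conv_hasSum (hp : IsPMF p) : HasSum (conv p p) 1 := by
  have h := fib hp (f := fun _ => 1) (by simpa using hasSum_w hp)
  simpa using h

lemma conv_isPMF (hp : IsPMF p) : IsPMF (conv p p) := ⟨conv_nonneg hp, conv_hasSum hp⟩

/-- product sums for `s(j) t(i+j)` -/
lemma hasSum_v (hp : IsPMF p) {s t : ℤ → ℝ} {a b : ℝ} (hs : HasSum (fun j => p j * s j) a)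
    (ht : HasSum (fun k => conv p p k * t k) b) :
    HasSum (fun z : ℤ × ℤ => s z.2 * t (z.1 + z.2) * (p z.2 * conv p p (z.1 + z.2))) (a * b) := by
  have h := prodSum hs ht
  rw [← shearF.hasSum_iff]
  convert h using 1
  ext z
  simp [shearF]
  ring

lemma summable_bdd {ι : Type*} {w g : ι → ℝ} (hw : ∀ i, 0 ≤ w i) (hs : Summable w)
    (hg : ∀ i, |g i| ≤ 1) : Summable (fun i => w i * g i) := by
  refine Summable.of_norm_bounded hs (fun i => ?_)
  rw [norm_eq_abs, abs_mul, abs_of_nonneg (hw i)]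
  exact mul_le_of_le_one_right (hw i) (hg i)

lemma hasSum_v1 (hp : IsPMF p) :
    HasSum (fun z : ℤ × ℤ => p z.2 * conv p p (z.1 + z.2)) 1 := by
  have h := hasSum_v hp (s := fun _ => 1) (t := fun _ => 1) (a := 1) (b := 1)
    (by simpa using hp.2) (by simpa using conv_hasSum hp)
  simpa using h

lemma summable_logw (hp : IsPMF p) {h : ℝ} (hL : HasSum (fun k => p k * log (p k)) h) :
    HasSum (fun z : ℤ × ℤ => p z.1 * log (p z.1) * p z.2) h ∧
    HasSum (fun z : ℤ × ℤ => p z.1 * (p z.2 * log (p z.2))) h := by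
  have h1 := hL.summable.abs
  have h2 := hp.2.summable.abs
  constructor
  · simpa using prodSum hL hp.2
  · simpa using prodSum hp.2 hL

lemma summable_logq (hp : IsPMF p) {h : ℝ} (hL : HasSum (fun k => p k * log (p k)) h) :
    Summable (fun z : ℤ × ℤ => p z.1 * p z.2 * log (conv p p (z.1 + z.2))) := by
  obtain ⟨h1, h2⟩ := summable_logw hp hL
  refine Summable.of_norm_bounded (h1.neg.add h2.neg).summable fun z => ?_
  have hw : 0 ≤ p z.1 * p z.2 := mul_nonneg (hp.1 _) (hp.1 _)
  have hq1 : conv p p (z.1 + z.2) ≤ 1 := p_le_one (conv_isPMF hp) _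
  have hlq : log (conv p p (z.1 + z.2)) ≤ 0 := log_nonpos (conv_nonneg hp _) hq1
  rw [norm_mul, norm_eq_abs, norm_eq_abs, abs_of_nonneg hw, abs_of_nonpos hlq]
  rcases hw.eq_or_lt with h0 | h0
  · rcases mul_eq_zero.mp h0.symm with h | h <;> simp [h]
  · have ha : p z.1 ≠ 0 := left_ne_zero_of_mul h0.ne'
    have hb : p z.2 ≠ 0 := right_ne_zero_of_mul h0.ne'
    have := log_le_log h0 (le_conv hp z.1 z.2)
    rw [log_mul ha hb] at this
    nlinarith [mul_le_mul_of_nonneg_left this hw]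

/-- Pinsker lower bound for the entropy increment (in nats). -/
lemma pinsker (hp : IsPMF p) {h : ℝ} (hL : HasSum (fun k => p k * log (p k)) h)
    {g : ℤ × ℤ → ℝ} (hg : ∀ z, |g z| ≤ 1) {A B : ℝ}
    (hA : HasSum (fun z => g z * (p z.1 * p z.2)) A)
    (hB : HasSum (fun z => g z * (p z.2 * conv p p (z.1 + z.2))) B) :
    (A - B) ^ 2 / 2 ≤ h - ∑' k, conv p p k * log (conv p p k) := by
  have hq := (summable_logq hp hL).hasSum
  have hq' := fib hp (f := fun k => log (conv p p k)) hq
  rw [hq'.tsum_eq]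
  have hw := hasSum_w hp
  have hv := hasSum_v1 hp
  have h1 := (summable_logw hp hL).1
  have hR := ((h1.sub hq).sub hw).add hv
  have hLft := ((hA.sub hB).mul_left (A - B)).sub
    ((hw.add (hv.mul_left 2)).mul_left ((A - B) ^ 2 / 6))
  have := hasSum_le (fun z => ?_) hLft hR
  · linarith
  · rcases (hp.1 z.2).eq_or_lt with h0 | h0
    · simp [← h0]
    rcases (conv_nonneg hp (z.1 + z.2)).eq_or_lt with h2 | h2
    · have h3 := le_conv hp z.1 z.2
      rw [← h2] at h3
      have h4 : p z.1 = 0 := by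
        have := hp.1 z.1
        by_contra hne
        have : 0 < p z.1 := lt_of_le_of_ne this (Ne.symm hne)
        have := mul_pos this h0
        linarith
      simp [← h2, h4]
    · have := mul_le_mul_of_nonneg_left
        (point_pinsker (t := A - B) (hp.1 z.1) h2 (hg z)) h0.le
      nlinarith [this]

/-- sign function of a half line -/
noncomputable def sg (n : ℤ) (j : ℤ) : ℝ := if j ≤ n then 1 else -1

lemma sg_abs (n j : ℤ) : |sg n j| ≤ 1 := by
  unfold sg; split_ifs <;> simp

lemma exists_n (hp : IsPMF p) {x : ℝ} (hx : ∀ k, p k ≤ x) (hx1 : x < 1) :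
    ∃ n : ℤ, |∑' j, p j * sg n j| ≤ x := by
  have hx0 : 0 ≤ x := (hp.1 0).trans (hx 0)
  have hsum : ∀ n, Summable (fun j => p j * sg n j) := fun n =>
    (summable_bdd hp.1 hp.2.summable (sg_abs n))
  have hbd : ∀ n k : ℤ, ‖p k * sg n k‖ ≤ p k := fun n k => by
    rw [norm_eq_abs, abs_mul, abs_of_nonneg (hp.1 k)]
    exact mul_le_of_le_one_right (hp.1 k) (sg_abs n k)
  have htop : Tendsto (fun n : ℤ => ∑' j, p j * sg n j) atTop (𝓝 (∑' j, p j * 1)) := by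
    refine tendsto_tsum_of_dominated_convergence hp.2.summable (fun k => ?_)
      (Eventually.of_forall fun n k => hbd n k)
    refine tendsto_const_nhds.congr' ?_
    filter_upwards [eventually_ge_atTop k] with n hn
    simp [sg, hn]
  have hbot : Tendsto (fun n : ℤ => ∑' j, p j * sg n j) atBot (𝓝 (∑' j, p j * (-1))) := by
    refine tendsto_tsum_of_dominated_convergence hp.2.summable (fun k => ?_)
      (Eventually.of_forall fun n k => hbd n k)
    refine tendsto_const_nhds.congr' ?_
    filter_upwards [eventually_lt_atBot k] with n hn
    simp [sg, not_le.mpr hn]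
  rw [tsum_mul_right, hp.2.tsum_eq] at htop hbot
  have h1 : ∃ n : ℤ, -x ≤ ∑' j, p j * sg n j :=
    ((htop.eventually (lt_mem_nhds (show -x < 1 * 1 by linarith))).exists).imp fun n hn => hn.le
  obtain ⟨b, hb⟩ := eventually_atBot.mp
    (hbot.eventually (gt_mem_nhds (show (1 : ℝ) * (-1) < -x by linarith)))
  obtain ⟨n, hn, hmin⟩ := Int.exists_least_of_bdd (P := fun n => -x ≤ ∑' j, p j * sg n j)
    ⟨b, fun z hz => by
      by_contra hlt
      have := hb z (by omega)
      linarith⟩ h1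
  refine ⟨n, abs_le.mpr ⟨hn, ?_⟩⟩
  have h2 : ∑' j, p j * sg (n - 1) j < -x := by
    by_contra hcon
    have := hmin (n - 1) (not_lt.mp hcon)
    omega
  have h3 : HasSum (fun j => p j * sg n j) (∑' j, p j * sg (n - 1) j + 2 * p n) := by
    have := (hsum (n - 1)).hasSum.add (hasSum_ite_eq n (2 * p n))
    refine hasSum_of_eq ?_ (this)
    intro j
    unfold sg
    rcases lt_trichotomy j n with h | h | h
    · simp [h.le, show j ≤ n - 1 by omega, h.ne]
    · subst h
      simp; ring
    · simp [not_le.mpr h, show ¬ (j ≤ n - 1) by omega, h.ne']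
  rw [h3.tsum_eq]
  linarith [hx n]

lemma case1 (hp : IsPMF p) {h : ℝ} (hL : HasSum (fun k => p k * log (p k)) h)
    {x : ℝ} (hx : ∀ k, p k ≤ x) (hx1 : x < 1) :
    ((1 - x) ^ 2 / 2) ^ 2 / 2 ≤ h - ∑' k, conv p p k * log (conv p p k) := by
  have hx0 : 0 ≤ x := (hp.1 0).trans (hx 0)
  obtain ⟨n, hn⟩ := exists_n hp hx hx1
  obtain ⟨m, hm⟩ : ∃ m, m = ∑' j, p j * sg n j := ⟨_, rfl⟩
  rw [← hm] at hn
  have habs := summable_bdd hp.1 hp.2.summable (sg_abs n)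
  have hs : HasSum (fun j => p j * sg n j) m := by rw [hm]; exact habs.hasSum
  have hw := hasSum_w hp
  have hw0 : ∀ z : ℤ × ℤ, 0 ≤ p z.1 * p z.2 := fun z => mul_nonneg (hp.1 _) (hp.1 _)
  obtain ⟨t, ht⟩ : ∃ t : ℤ → ℝ, t = sg (2 * n + 1) := ⟨_, rfl⟩
  have htb : ∀ k, |t k| ≤ 1 := fun k => by rw [ht]; exact sg_abs _ _
  have ht1 : Summable (fun z : ℤ × ℤ => p z.1 * p z.2 * t (z.1 + z.2)) :=
    summable_bdd (w := fun z : ℤ × ℤ => p z.1 * p z.2) hw0 hw.summable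
      (g := fun z : ℤ × ℤ => t (z.1 + z.2)) (fun z => htb (z.1 + z.2))
  obtain ⟨τ, hτd⟩ : ∃ τ, τ = ∑' z : ℤ × ℤ, p z.1 * p z.2 * t (z.1 + z.2) := ⟨_, rfl⟩
  have hτ : HasSum (fun z : ℤ × ℤ => p z.1 * p z.2 * t (z.1 + z.2)) τ := by
    rw [hτd]; exact ht1.hasSum
  have hτ' : HasSum (fun k => conv p p k * t k) τ := fib (f := t) hp hτ
  have hB := hasSum_v (s := sg n) (t := t) hp hs hτ'
  -- single sums
  have e1 : HasSum (fun z : ℤ × ℤ => p z.1 * sg n z.1 * p z.2) m := by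
    simpa using prodSum hs hp.2
  have e2 : HasSum (fun z : ℤ × ℤ => p z.1 * (p z.2 * sg n z.2)) m := by
    simpa using prodSum hp.2 hs
  have e12 : HasSum (fun z : ℤ × ℤ => p z.1 * sg n z.1 * (p z.2 * sg n z.2)) (m * m) :=
    prodSum (f := fun j => p j * sg n j) (g := fun j => p j * sg n j) hs hs
  -- the P-sum
  have hg : ∀ z : ℤ × ℤ, |sg n z.2 * t (z.1 + z.2)| ≤ 1 := fun z => by
    rw [abs_mul]; exact mul_le_one₀ (sg_abs _ _) (abs_nonneg _) (htb _)
  have hAs : Summable (fun z : ℤ × ℤ => sg n z.2 * t (z.1 + z.2) * (p z.1 * p z.2)) := by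
    have := summable_bdd (w := fun z : ℤ × ℤ => p z.1 * p z.2)
      (g := fun z : ℤ × ℤ => sg n z.2 * t (z.1 + z.2)) hw0 hw.summable hg
    exact this.congr fun z => by ring
  obtain ⟨A, hAd⟩ : ∃ A, A = ∑' z : ℤ × ℤ, sg n z.2 * t (z.1 + z.2) * (p z.1 * p z.2) := ⟨_, rfl⟩
  have hA : HasSum (fun z : ℤ × ℤ => sg n z.2 * t (z.1 + z.2) * (p z.1 * p z.2)) A := by
    rw [hAd]; exact hAs.hasSum
  have hA' : HasSum (fun z : ℤ × ℤ => sg n z.1 * t (z.1 + z.2) * (p z.1 * p z.2)) A := by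
    rw [← (Equiv.prodComm ℤ ℤ).hasSum_iff]
    convert hA using 1
    ext z
    simp [add_comm, mul_comm]
  have hcases : ∀ z : ℤ × ℤ,
      (sg n z.1 + sg n z.2) * t (z.1 + z.2) = 1 + sg n z.1 * sg n z.2 ∧
      |2 * t (z.1 + z.2) - sg n z.1 - sg n z.2| ≤ 1 - sg n z.1 * sg n z.2 := by
    intro z
    simp only [ht, sg]
    by_cases h1 : z.1 ≤ n <;> by_cases h2 : z.2 ≤ n
    · simp [h1, h2, show z.1 + z.2 ≤ 2 * n + 1 by omega]; norm_num
    · simp only [h1, h2, if_true, if_false]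
      split_ifs <;> norm_num
    · simp only [h1, h2, if_true, if_false]
      split_ifs <;> norm_num
    · simp [h1, h2, show ¬ (z.1 + z.2 ≤ 2 * n + 1) by omega]; norm_num
  have hAval : A + A = 1 + m * m := by
    refine (hA'.add hA).unique ?_
    refine hasSum_of_eq ?_ ((hw.add e12))
    intro z
    linear_combination (p z.1 * p z.2) * (hcases z).1
  have hd := ((hτ.mul_left 2).sub e1).sub e2
  have hu : 2 * τ - m - m ≤ 1 - m * m := by
    refine hasSum_le (fun z => ?_) hd (hw.sub e12)
    have := mul_le_mul_of_nonneg_left (abs_le.mp (hcases z).2).2 (hw0 z)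
    linarith
  have hl : -(1 - m * m) ≤ 2 * τ - m - m := by
    refine hasSum_le (fun z => ?_) (hw.sub e12).neg hd
    have := mul_le_mul_of_nonneg_left (abs_le.mp (hcases z).2).1 (hw0 z)
    linarith
  have hpin := pinsker hp hL hg hA hB
  refine le_trans ?_ hpin
  have hmx := abs_le.mp hn
  have hkey : (1 - x) ^ 2 / 2 ≤ A - m * τ := by
    have h1 : (1 - |m|) * (1 - m ^ 2) / 2 ≤ A - m * τ := by
      rcases abs_cases m with ⟨h, h'⟩ | ⟨h, h'⟩
      · rw [h]; nlinarith
      · rw [h]; nlinarith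
    refine le_trans ?_ h1
    have h2 : m ^ 2 = |m| ^ 2 := (sq_abs m).symm
    rw [h2]
    have h3 := abs_nonneg m
    have h4 : 1 - x ≤ 1 - |m| := by linarith
    have h5 : 1 - x ≤ 1 - |m| ^ 2 := by nlinarith
    have := mul_le_mul h4 h5 (by linarith) (by linarith)
    nlinarith
  have h0 : 0 ≤ (1 - x) ^ 2 / 2 := by positivity
  have := pow_le_pow_left₀ h0 hkey 2
  linarith

lemma case2 (hp : IsPMF p) {h : ℝ} (hL : HasSum (fun k => p k * log (p k)) h)
    {x : ℝ} (hx : ∀ k, p k ≤ x) {i : ℤ} (hi : p i = x) (hx2 : 1 / 2 ≤ x) :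
    ((1 - x) * (2 * x - 1)) ^ 2 / 2 ≤ h - ∑' k, conv p p k * log (conv p p k) := by
  have hx1 : x ≤ 1 := hi ▸ p_le_one hp i
  have hoth : ∀ k, k ≠ i → p k ≤ 1 - x := by
    intro k hk
    have h1 := sum_le_hasSum {k, i} (fun j _ => hp.1 j) hp.2
    rw [Finset.sum_pair hk] at h1
    linarith
  have hqx : ∀ k, conv p p k ≤ x := by
    intro k
    have h1 := hasSum_le (fun j => mul_le_mul_of_nonneg_left (hx (k - j)) (hp.1 j))
      (summable_conv hp k).hasSum (hp.2.mul_right x)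
    simpa [conv] using h1
  have hq2 : conv p p (i + i) ≤ (1 - x) ^ 2 + x ^ 2 := by
    have h1 := hasSum_le (fun j => ?_) (summable_conv hp (i + i)).hasSum
      ((hp.2.mul_right (1 - x)).add (hasSum_ite_eq i (x ^ 2 - x * (1 - x))))
    · simp only [conv]
      linarith
    · by_cases hj : j = i
      · subst hj
        simp [hi]; linarith
      · simp only [hj, if_false, add_zero]
        exact mul_le_mul_of_nonneg_left (hoth _ (by omega)) (hp.1 j)
  -- test function
  let g : ℤ × ℤ → ℝ := fun z => if z.1 = i then 1 else -1
  have hg : ∀ z, |g z| ≤ 1 := fun z => by simp only [g]; split_ifs <;> simp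
  have hw := hasSum_w hp
  have hv := hasSum_v1 hp
  have hv0 : ∀ z : ℤ × ℤ, 0 ≤ p z.2 * conv p p (z.1 + z.2) :=
    fun z => mul_nonneg (hp.1 _) (conv_nonneg hp _)
  have hA : HasSum (fun z : ℤ × ℤ => g z * (p z.1 * p z.2)) (2 * x - 1) := by
    have h1 := prodSum (hasSum_ite_eq i x) hp.2
    have h2 := (h1.mul_left 2).sub hw
    rw [mul_one] at h2
    refine hasSum_of_eq ?_ (h2)
    intro z
    simp only [g]
    split_ifs with hz
    · rw [hz, hi]; ring
    · ring
  have hBs : Summable (fun z : ℤ × ℤ => g z * (p z.2 * conv p p (z.1 + z.2))) :=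
    ((summable_bdd hv0 hv.summable hg)).congr fun z => by ring
  obtain ⟨B, hB⟩ := hBs
  have hC : HasSum (fun z : ℤ × ℤ => if z.1 = i then p z.2 * conv p p (z.1 + z.2) else 0)
      ((B + 1) / 2) := by
    refine hasSum_of_eq ?_ (((hB.add hv).div_const 2))
    intro z
    simp only [g]
    split_ifs <;> ring
  have hU : HasSum (fun z : ℤ × ℤ => if z.1 = i then
      p z.2 * x + (if z.2 = i then x * (conv p p (i + i) - x) else 0) else 0)
      (1 * x + x * (conv p p (i + i) - x)) := by
    have h1 := (hp.2.mul_right x).add (hasSum_ite_eq i (x * (conv p p (i + i) - x)))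
    have h2 := prodSum (hasSum_ite_eq i (1 : ℝ)) h1
    rw [one_mul] at h2
    refine hasSum_of_eq ?_ (h2)
    intro z
    by_cases hz : z.1 = i <;> simp [hz]
  have hle := hasSum_le (fun z => ?_) hC hU
  rotate_left
  · by_cases hz : z.1 = i
    · by_cases hz2 : z.2 = i
      · simp only [hz, hz2, if_true, hi]; linarith
      · simp only [hz, hz2, if_true, if_false, add_zero]
        exact mul_le_mul_of_nonneg_left (hqx _) (hp.1 _)
    · simp [hz]
  have hpin := pinsker hp hL hg hA hB
  refine le_trans ?_ hpin
  have hkey : (1 - x) * (2 * x - 1) ≤ 2 * x - 1 - B := by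
    have h1 : x * conv p p (i + i) ≤ x * ((1 - x) ^ 2 + x ^ 2) :=
      mul_le_mul_of_nonneg_left hq2 (by linarith)
    have h2 : 0 ≤ (1 - x) * (2 * x - 1) * (2 * x - 1) :=
      mul_nonneg (mul_nonneg (by linarith) (by linarith)) (by linarith)
    nlinarith
  have h0 : 0 ≤ (1 - x) * (2 * x - 1) := mul_nonneg (by linarith) (by linarith)
  have := pow_le_pow_left₀ h0 hkey 2
  linarith

lemma case0 (hp : IsPMF p) {h : ℝ} (hL : HasSum (fun k => p k * log (p k)) h) :
    0 ≤ h - ∑' k, conv p p k * log (conv p p k) := by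
  have := pinsker hp hL (g := fun _ => 0) (by simp) (A := 0) (B := 0)
    (by simpa using hasSum_zero) (by simpa using hasSum_zero)
  simpa using this

end

/-- if `H(p) = c` is finite and `x = ‖p‖_∞`, then
`H(p⋆p) − c ≥ ((1−x)²/(8 ln 2))·((1−x) ∨ (4x−2)⁺)²`. -/
theorem stmt11 (p : ℤ → ℝ) (c x : ℝ) (hp : IsPMF p)
    (hc : HasSum (fun k => -(p k * Real.logb 2 (p k))) c)
    (hx : x = ⨆ i, p i) :
    entH (conv p p) - c ≥
      (1 - x) ^ 2 / (8 * Real.log 2) * (max (1 - x) (max (4 * x - 2) 0)) ^ 2 := by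
  have hl2 : 0 < Real.log 2 := Real.log_pos one_lt_two
  have hbdd : BddAbove (Set.range p) := ⟨1, by rintro _ ⟨k, rfl⟩; exact p_le_one hp k⟩
  have hxk : ∀ k, p k ≤ x := fun k => hx ▸ le_ciSup hbdd k
  have hx1 : x ≤ 1 := hx ▸ ciSup_le fun k => p_le_one hp k
  have hL : HasSum (fun k => p k * Real.log (p k)) (c * (-Real.log 2)) := by
    refine hasSum_of_eq ?_ ((hc.mul_right (-Real.log 2)))
    intro k
    simp only [Real.logb]
    field_simp
  have hE : entH (conv p p) = (-∑' k, conv p p k * Real.log (conv p p k)) / Real.log 2 := by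
    unfold entH
    rw [← tsum_neg, ← tsum_div_const]
    congr 1
    ext k
    simp only [Real.logb]
    ring
  set S := ∑' k, conv p p k * Real.log (conv p p k) with hS
  have main : (1 - x) ^ 2 * (max (1 - x) (max (4 * x - 2) 0)) ^ 2 / 8 ≤
      c * (-Real.log 2) - S := by
    rcases hx1.eq_or_lt with h1 | h1
    · have := case0 hp hL
      rw [h1] at *
      simpa using this
    · rcases max_choice (1 - x) (max (4 * x - 2) 0) with h | h
      · rw [h]
        have := case1 hp hL hxk h1
        refine le_trans (le_of_eq ?_) this
        ring
      · rw [h]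
        rcases le_or_gt (4 * x - 2) 0 with h2 | h2
        · rw [max_eq_right h2]
          have := case0 hp hL
          simpa using this
        · rw [max_eq_left h2.le]
          obtain ⟨i, hi⟩ := exists_lt_of_lt_ciSup (show (1 / 2 : ℝ) < ⨆ i, p i by linarith)
          have hix : p i = x := by
            refine le_antisymm (hxk i) ?_
            rw [hx]
            refine ciSup_le fun k => ?_
            by_cases hk : k = i
            · rw [hk]
            · have h3 := sum_le_hasSum {k, i} (fun j _ => hp.1 j) hp.2
              rw [Finset.sum_pair hk] at h3
              linarith
          have := case2 hp hL hxk hix (by linarith)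
          refine le_trans (le_of_eq ?_) this
          ring
  have hfin : entH (conv p p) - c = (c * (-Real.log 2) - S) / Real.log 2 := by
    rw [hE]; field_simp; ring
  rw [hfin, ge_iff_le, le_div_iff₀ hl2]
  refine le_trans (le_of_eq ?_) main
  field_simp
end

section
/- Let p, q be probability distributions on ℤ with finite entropies H(p) = c and H(q) = d, let 0 < α, β < 1/2 and m, n ∈ ℤ be such that α ≤ p((−∞,m]) ≤ 1−α and β ≤ q((−∞,n]) ≤ 1−β, and let p₁ = p|_{(−∞,m]}/p((−∞,m]), p₂ = p|_{[m+1,∞)}/p([m+1,∞)), q₁ = q|_{(−∞,n]}/q((−∞,n]), q₂ = q|_{[n+1,∞)}/q([n+1,∞)). Then H(p⋆q) − d ≥ (α²/(2 ln 2)) · ‖q⋆p₁ − q⋆p₂‖₁² and H(p⋆q) − c ≥ (β²/(2 ln 2)) · ‖p⋆q₁ − p⋆q₂‖₁². -/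
/-- `p((−∞,n])`, the total mass of `p` on `(−∞,n]`. -/
noncomputable def headMass (p : ℤ → ℝ) (n : ℤ) : ℝ := ∑' k, if k ≤ n then p k else 0

/-- `p([n+1,∞))`, the total mass of `p` on `[n+1,∞)`. -/
noncomputable def tailMass (p : ℤ → ℝ) (n : ℤ) : ℝ := ∑' k, if n + 1 ≤ k then p k else 0

/-- The normalized restriction `p|_{(−∞,n]} / p((−∞,n])`. -/
noncomputable def headPart (p : ℤ → ℝ) (n : ℤ) : ℤ → ℝ :=
  fun k => if k ≤ n then p k / headMass p n else 0

/-- The normalized restriction `p|_{[n+1,∞)} / p([n+1,∞))`. -/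
noncomputable def tailPart (p : ℤ → ℝ) (n : ℤ) : ℤ → ℝ :=
  fun k => if n + 1 ≤ k then p k / tailMass p n else 0

/-- The `ℓ₁`-distance of two functions on `ℤ`. -/
noncomputable def l1dist (f g : ℤ → ℝ) : ℝ := ∑' k, |f k - g k|

lemma hasSum_congr_fun {ι : Type*} {f g : ι → ℝ} {a : ℝ} (h : HasSum g a)
    (e : ∀ i, f i = g i) : HasSum f a := by
  rwa [funext e]

/-- Nonnegativity of the one-variable function in Pinsker's inequality. -/
lemma aux_pinsker {x : ℝ} (hx : 0 ≤ x) :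
    3 * (x - 1) ^ 2 ≤ (4 + 2 * x) * (x * Real.log x - x + 1) := by
  have hd : ∀ y : ℝ, y ∈ Set.Ioi (0 : ℝ) → HasDerivAt
      (fun y : ℝ => (4 + 2 * y) * (y * Real.log y - y + 1) - 3 * (y - 1) ^ 2)
      (4 * ((y + 1) * Real.log y - 2 * (y - 1))) y := by
    intro y hy
    have hy' : y ≠ 0 := ne_of_gt hy
    have h1 : HasDerivAt (fun y : ℝ => 4 + 2 * y) 2 y := by
      simpa using ((hasDerivAt_id y).const_mul 2).const_add 4
    have h2 : HasDerivAt (fun y : ℝ => y * Real.log y - y + 1) (Real.log y + 1 - 1) y :=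
      ((Real.hasDerivAt_mul_log hy').sub (hasDerivAt_id y)).add_const 1
    have h3 : HasDerivAt (fun y : ℝ => 3 * (y - 1) ^ 2) (3 * (2 * (y - 1))) y := by
      have := (((hasDerivAt_id y).sub_const 1).pow 2).const_mul 3
      simpa using this
    have := (h1.mul h2).sub h3
    refine this.congr_deriv ?_
    ring
  have hd2 : ∀ y : ℝ, y ∈ Set.Ioi (0 : ℝ) → HasDerivAt
      (fun y : ℝ => 4 * ((y + 1) * Real.log y - 2 * (y - 1)))
      (4 * (Real.log y + 1 / y - 1)) y := by
    intro y hy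
    have hy' : y ≠ 0 := ne_of_gt hy
    have h1 : HasDerivAt (fun y : ℝ => y + 1) 1 y := (hasDerivAt_id y).add_const 1
    have h3 : HasDerivAt (fun y : ℝ => 2 * (y - 1)) 2 y := by
      simpa using ((hasDerivAt_id y).sub_const 1).const_mul 2
    have := (((h1.mul (Real.hasDerivAt_log hy')).sub h3)).const_mul 4
    refine this.congr_deriv ?_
    field_simp
    ring
  have hmono : MonotoneOn (fun y : ℝ => 4 * ((y + 1) * Real.log y - 2 * (y - 1)))
      (Set.Ioi 0) := by
    apply monotoneOn_of_deriv_nonneg (convex_Ioi 0)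
    · exact fun y hy => (hd2 y hy).continuousAt.continuousWithinAt
    · intro y hy
      rw [interior_Ioi] at hy
      exact (hd2 y hy).differentiableAt.differentiableWithinAt
    · intro y hy
      rw [interior_Ioi] at hy
      rw [(hd2 y hy).deriv]
      have := Real.one_sub_inv_le_log_of_pos hy
      rw [one_div]
      linarith
  rcases hx.eq_or_lt with rfl | hx
  · norm_num
  suffices h : 0 ≤ (4 + 2 * x) * (x * Real.log x - x + 1) - 3 * (x - 1) ^ 2 by linarith
  rcases le_total x 1 with h1 | h1
  · have ha : AntitoneOn (fun y : ℝ => (4 + 2 * y) * (y * Real.log y - y + 1) - 3 * (y - 1) ^ 2)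
        (Set.Ioc 0 1) := by
      apply antitoneOn_of_deriv_nonpos (convex_Ioc 0 1)
      · exact fun y hy => (hd y hy.1).continuousAt.continuousWithinAt
      · intro y hy
        have hy := interior_subset hy
        exact (hd y hy.1).differentiableAt.differentiableWithinAt
      · intro y hy
        have hy := interior_subset hy
        rw [(hd y hy.1).deriv]
        simpa using hmono (a := y) (b := 1) hy.1 (by norm_num) hy.2
    simpa using ha (a := x) (b := 1) ⟨hx, h1⟩ (by norm_num) h1
  · have ha : MonotoneOn (fun y : ℝ => (4 + 2 * y) * (y * Real.log y - y + 1) - 3 * (y - 1) ^ 2)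
        (Set.Ici 1) := by
      have hpos : ∀ y : ℝ, y ∈ Set.Ici (1 : ℝ) → y ∈ Set.Ioi (0 : ℝ) := fun y hy =>
        Set.mem_Ioi.2 (lt_of_lt_of_le one_pos (Set.mem_Ici.1 hy))
      apply monotoneOn_of_deriv_nonneg (convex_Ici 1)
      · exact fun y hy => (hd y (hpos y hy)).continuousAt.continuousWithinAt
      · intro y hy
        have hy := interior_subset hy
        exact (hd y (hpos y hy)).differentiableAt.differentiableWithinAt
      · intro y hy
        have hy := interior_subset hy
        rw [(hd y (hpos y hy)).deriv]
        simpa using hmono (a := 1) (b := y) (by norm_num) (hpos y hy) hy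
    simpa using ha (a := 1) (b := x) (by norm_num) h1 h1

/-- Pointwise linearised Pinsker bound. -/
lemma aux_point {u v t : ℝ} (hu : 0 ≤ u) (hv : 0 ≤ v) (huv : v = 0 → u = 0) (ht : 0 < t) :
    |u - v| ≤ t * ((4 * v + 2 * u) / 6) +
      (u * (Real.log u - Real.log v) - u + v) / (2 * t) := by
  rcases hv.eq_or_lt with h0 | hv
  · have h1 := huv h0.symm
    subst h1
    simp [← h0]
  have hk : 3 * (u - v) ^ 2 ≤
      (4 * v + 2 * u) * (u * (Real.log u - Real.log v) - u + v) := by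
    have h := aux_pinsker (x := u / v) (by positivity)
    have hl : u / v * Real.log (u / v) = u / v * (Real.log u - Real.log v) := by
      rcases hu.eq_or_lt with h0 | hu
      · simp [← h0]
      · rw [Real.log_div hu.ne' hv.ne']
    rw [hl] at h
    have h2 := mul_le_mul_of_nonneg_right h (sq_nonneg v)
    have e1 : 3 * (u / v - 1) ^ 2 * v ^ 2 = 3 * (u - v) ^ 2 := by field_simp
    have e2 : (4 + 2 * (u / v)) * (u / v * (Real.log u - Real.log v) - u / v + 1) * v ^ 2
      = (4 * v + 2 * u) * (u * (Real.log u - Real.log v) - u + v) := by field_simp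
    rwa [e1, e2] at h2
  set A := 4 * v + 2 * u with hA
  set B := u * (Real.log u - Real.log v) - u + v with hB
  have hA0 : 0 < A := by positivity
  have hB0 : 0 ≤ B := by
    by_contra hneg
    push Not at hneg
    nlinarith [mul_neg_of_pos_of_neg hA0 hneg, sq_nonneg (u - v)]
  have hC : 0 ≤ t * (A / 6) + B / (2 * t) := by positivity
  refine abs_le_of_sq_le_sq ?_ hC
  have : 4 * ((t * (A / 6)) * (B / (2 * t))) = A * B / 3 := by field_simp; ring
  nlinarith [sq_nonneg (t * (A / 6) - B / (2 * t))]

/-- Pinsker's inequality (in nats) on a countable index type. -/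
lemma pinsker_s14 {ι : Type*} {u v : ι → ℝ} {D : ℝ} (hu : ∀ i, 0 ≤ u i) (hv : ∀ i, 0 ≤ v i)
    (huv : ∀ i, v i = 0 → u i = 0) (hu1 : HasSum u 1) (hv1 : HasSum v 1)
    (hD : HasSum (fun i => u i * (Real.log (u i) - Real.log (v i))) D) :
    (∑' i, |u i - v i|) ^ 2 ≤ 2 * D := by
  have hs : Summable (fun i => |u i - v i|) := (hu1.summable.sub hv1.summable).abs
  have key : ∀ t : ℝ, 0 < t → ∑' i, |u i - v i| ≤ t + D / (2 * t) := by
    intro t ht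
    have h := hasSum_le (fun i => aux_point (hu i) (hv i) (huv i) ht) hs.hasSum
      (((((hv1.mul_left 4).add (hu1.mul_left 2)).div_const 6).mul_left t).add
        (((hD.sub hu1).add hv1).div_const (2 * t)))
    refine h.trans (le_of_eq ?_)
    norm_num
  have h0 : 0 ≤ ∑' i, |u i - v i| := tsum_nonneg fun i => abs_nonneg _
  set L := ∑' i, |u i - v i| with hL
  rcases h0.eq_or_lt with h0 | h0
  · have := hasSum_le (fun i => aux_point (hu i) (hv i) (huv i) one_pos) hs.hasSum
      (((((hv1.mul_left 4).add (hu1.mul_left 2)).div_const 6).mul_left 1).add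
        (((hD.sub hu1).add hv1).div_const (2 * 1)))
    -- `D ≥ 0` because each `u = v`
    have hz : ∀ i, u i - v i = 0 := by
      intro i
      have := (hasSum_zero_iff_of_nonneg (fun i => abs_nonneg (u i - v i))).1
        (by rw [h0]; exact hs.hasSum)
      exact abs_eq_zero.1 (congrFun this i)
    have hD0 : D = 0 := by
      refine hD.unique ?_
      refine hasSum_congr_fun (hasSum_zero) fun i => ?_
      have := hz i
      rw [show u i = v i by linarith]; simp
    rw [← h0, hD0]; simp
  · have h := key (L / 2) (by positivity)
    have e : D / (2 * (L / 2)) = D / L := by ring_nf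
    rw [e] at h
    have h2 : L / 2 ≤ D / L := by linarith
    rw [le_div_iff₀ h0] at h2
    nlinarith

/-- The shear `(k, j) ↦ (j, k - j)`. -/
def shear : ℤ × ℤ ≃ ℤ × ℤ where
  toFun x := (x.2, x.1 - x.2)
  invFun y := (y.1 + y.2, y.1)
  left_inv x := by ext <;> simp
  right_inv y := by ext <;> simp

lemma hasSum_shear {f g : ℤ → ℝ} {a b : ℝ} (hf : HasSum f a) (hg : HasSum g b) :
    HasSum (fun x : ℤ × ℤ => f x.2 * g (x.1 - x.2)) (a * b) := by
  have h : HasSum (fun x : ℤ × ℤ => f x.1 * g x.2) (a * b) :=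
    hf.mul hg (summable_mul_of_summable_norm hf.summable.norm hg.summable.norm)
  exact (shear.hasSum_iff (f := fun x : ℤ × ℤ => f x.1 * g x.2)).2 h

lemma conv_comm' (p q : ℤ → ℝ) : conv p q = conv q p := by
  funext k
  unfold conv
  rw [← (Equiv.subLeft k).tsum_eq]
  refine tsum_congr fun j => ?_
  simp [mul_comm]

lemma key (p q : ℤ → ℝ) (c d α : ℝ) (m : ℤ) (hp : IsPMF p) (hq : IsPMF q)
    (hc : HasSum (fun k => -(p k * Real.logb 2 (p k))) c)
    (hd : HasSum (fun k => -(q k * Real.logb 2 (q k))) d)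
    (hα₀ : 0 < α)
    (hpm₁ : α ≤ headMass p m) (hpm₂ : headMass p m ≤ 1 - α) :
    entH (conv p q) - d ≥
      α ^ 2 / (2 * Real.log 2) *
        (l1dist (conv q (headPart p m)) (conv q (tailPart p m))) ^ 2 := by
  obtain ⟨hp0, hp1⟩ := hp
  obtain ⟨hq0, hq1⟩ := hq
  have hl2 : 0 < Real.log 2 := Real.log_pos (by norm_num)
  -- entropies in nats
  have toNat : ∀ {s : ℤ → ℝ} {e : ℝ}, HasSum (fun k => -(s k * Real.logb 2 (s k))) e →
      HasSum (fun k => s k * Real.log (s k)) (-(e * Real.log 2)) := by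
    intro s e h
    refine hasSum_congr_fun ((h.mul_right (Real.log 2)).neg) fun k => ?_
    simp only [Real.logb]; field_simp
  have hc' := toNat hc
  have hd' := toNat hd
  set r := conv p q with hr
  -- joint law
  have hU : HasSum (fun x : ℤ × ℤ => p x.2 * q (x.1 - x.2)) 1 := by
    simpa using hasSum_shear hp1 hq1
  have hrk : ∀ k, HasSum (fun j => p j * q (k - j)) (r k) := fun k =>
    (hU.summable.prod_factor k).hasSum
  have hr1 : HasSum r 1 := hU.prod_fiberwise hrk
  have hr0 : ∀ k, 0 ≤ r k := fun k => (hrk k).nonneg fun j => mul_nonneg (hp0 j) (hq0 _)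
  have hle : ∀ k j, p j * q (k - j) ≤ r k := fun k j =>
    le_hasSum (hrk k) j fun i _ => mul_nonneg (hp0 i) (hq0 _)
  have hrle : ∀ k, r k ≤ 1 := fun k => le_hasSum hr1 k fun i _ => hr0 i
  have hA := hasSum_shear hp1 hd'
  have hC := hasSum_shear hc' hq1
  have hBs : Summable (fun x : ℤ × ℤ => p x.2 * q (x.1 - x.2) * Real.log (r x.1)) := by
    refine Summable.of_norm_bounded (hA.summable.add hC.summable).neg ?_
    rintro ⟨k, j⟩
    simp only
    have hpq := hle k j
    have hn := Real.log_nonpos (hr0 k) (hrle k)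
    rw [Real.norm_eq_abs, abs_mul, abs_of_nonneg (mul_nonneg (hp0 j) (hq0 _)), abs_of_nonpos hn]
    rcases (hp0 j).eq_or_lt with h | h1
    · simp [← h]
    rcases (hq0 (k - j)).eq_or_lt with h | h2
    · simp [← h]
    have hlog := Real.log_le_log (mul_pos h1 h2) hpq
    rw [Real.log_mul h1.ne' h2.ne'] at hlog
    nlinarith [mul_le_mul_of_nonneg_left hlog (mul_pos h1 h2).le]
  have hB : HasSum (fun k => r k * Real.log (r k))
      (∑' x : ℤ × ℤ, p x.2 * q (x.1 - x.2) * Real.log (r x.1)) :=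
    hBs.hasSum.prod_fiberwise fun k => (hrk k).mul_right _
  set R := ∑' x : ℤ × ℤ, p x.2 * q (x.1 - x.2) * Real.log (r x.1) with hR
  have hent : entH r = -(R / Real.log 2) := by
    refine HasSum.tsum_eq ?_
    refine hasSum_congr_fun ((hB.div_const (Real.log 2)).neg) fun k => ?_
    simp only [Real.logb]; ring
  have hV : HasSum (fun x : ℤ × ℤ => p x.2 * r x.1) 1 := by
    have h : HasSum (fun x : ℤ × ℤ => r x.1 * p x.2) (1 * 1) :=
      hr1.mul hp1 (summable_mul_of_summable_norm hr1.summable.norm hp1.summable.norm)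
    simpa [mul_comm] using h
  have hD : HasSum (fun x : ℤ × ℤ => p x.2 * q (x.1 - x.2) *
      (Real.log (p x.2 * q (x.1 - x.2)) - Real.log (p x.2 * r x.1)))
      (1 * -(d * Real.log 2) - R) := by
    refine hasSum_congr_fun (hA.sub hBs.hasSum) fun x => ?_
    obtain ⟨k, j⟩ := x
    simp only
    rcases (hp0 j).eq_or_lt with h | h1
    · simp [← h]
    rcases (hq0 (k - j)).eq_or_lt with h | h2
    · simp [← h]
    have h3 := lt_of_lt_of_le (mul_pos h1 h2) (hle k j)
    rw [Real.log_mul h1.ne' h2.ne', Real.log_mul h1.ne' h3.ne']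
    ring
  have hP := pinsker_s14 (fun x : ℤ × ℤ => mul_nonneg (hp0 x.2) (hq0 (x.1 - x.2)))
    (fun x : ℤ × ℤ => mul_nonneg (hp0 x.2) (hr0 x.1)) (by
      rintro ⟨k, j⟩ h
      simp only at h ⊢
      rcases mul_eq_zero.1 h with h | h
      · simp [h]
      · exact le_antisymm (h ▸ hle k j) (mul_nonneg (hp0 j) (hq0 _))) hU hV hD
  have hLs : Summable (fun x : ℤ × ℤ => |p x.2 * q (x.1 - x.2) - p x.2 * r x.1|) :=
    (hU.summable.sub hV.summable).abs
  set L := ∑' x : ℤ × ℤ, |p x.2 * q (x.1 - x.2) - p x.2 * r x.1| with hL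
  -- head and tail parts
  have hhs : Summable (fun k => if k ≤ m then p k else 0) := by
    refine Summable.of_nonneg_of_le (fun k => ?_) (fun k => ?_) hp1.summable
    · split_ifs; exacts [hp0 k, le_rfl]
    · split_ifs; exacts [le_rfl, hp0 k]
  have hts : Summable (fun k => if m + 1 ≤ k then p k else 0) := by
    refine Summable.of_nonneg_of_le (fun k => ?_) (fun k => ?_) hp1.summable
    · split_ifs; exacts [hp0 k, le_rfl]
    · split_ifs; exacts [le_rfl, hp0 k]
  have hsum : headMass p m + tailMass p m = 1 := by
    refine (hhs.hasSum.add hts.hasSum).unique ?_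
    refine hasSum_congr_fun (hp1) fun k => ?_
    by_cases h : k ≤ m
    · simp [h, show ¬ (m + 1 ≤ k) by omega]
    · simp [h, show (m + 1 ≤ k) by omega]
  have ha : 0 < headMass p m := lt_of_lt_of_le hα₀ hpm₁
  have hb1 : α ≤ tailMass p m := by linarith
  have hb : 0 < tailMass p m := lt_of_lt_of_le hα₀ hb1
  have hh1 : HasSum (headPart p m) 1 := by
    have h := hhs.hasSum.div_const (headMass p m)
    have e : (∑' k, if k ≤ m then p k else 0) = headMass p m := rfl
    rw [e, div_self ha.ne'] at h
    refine hasSum_congr_fun (h) fun k => ?_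
    simp only [headPart, ite_div, zero_div]
  have ht1 : HasSum (tailPart p m) 1 := by
    have h := hts.hasSum.div_const (tailMass p m)
    have e : (∑' k, if m + 1 ≤ k then p k else 0) = tailMass p m := rfl
    rw [e, div_self hb.ne'] at h
    refine hasSum_congr_fun (h) fun k => ?_
    simp only [tailPart, ite_div, zero_div]
  have hw : ∀ j, |headPart p m j - tailPart p m j| ≤ p j / α := by
    intro j
    unfold headPart tailPart
    by_cases h : j ≤ m
    · rw [if_pos h, if_neg (by omega), sub_zero, abs_of_nonneg (div_nonneg (hp0 j) ha.le)]
      exact div_le_div_of_nonneg_left (hp0 j) hα₀ hpm₁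
    · rw [if_neg h, if_pos (by omega), zero_sub, abs_neg,
        abs_of_nonneg (div_nonneg (hp0 j) hb.le)]
      exact div_le_div_of_nonneg_left (hp0 j) hα₀ hb1
  have hpt : ∀ k, |conv q (headPart p m) k - conv q (tailPart p m) k| ≤
      (∑' j, |p j * q (k - j) - p j * r k|) / α := by
    intro k
    have hf : HasSum (fun j => headPart p m j * q (k - j)) (conv q (headPart p m) k) := by
      rw [conv_comm']
      exact ((hasSum_shear hh1 hq1).summable.prod_factor k).hasSum
    have hg : HasSum (fun j => tailPart p m j * q (k - j)) (conv q (tailPart p m) k) := by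
      rw [conv_comm']
      exact ((hasSum_shear ht1 hq1).summable.prod_factor k).hasSum
    have h := (hf.sub hg).sub ((hh1.sub ht1).mul_right (r k))
    rw [sub_self, zero_mul, sub_zero] at h
    rw [← h.tsum_eq, ← tsum_div_const]
    have hbd : Summable (fun j => |p j * q (k - j) - p j * r k| / α) :=
      (hLs.prod_factor k).div_const α
    rw [← Real.norm_eq_abs]
    refine tsum_of_norm_bounded hbd.hasSum fun j => ?_
    have e : headPart p m j * q (k - j) - tailPart p m j * q (k - j) -
        (headPart p m j - tailPart p m j) * r k =
        (headPart p m j - tailPart p m j) * (q (k - j) - r k) := by ring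
    rw [Real.norm_eq_abs, e, abs_mul, ← mul_sub, abs_mul, abs_of_nonneg (hp0 j)]
    calc _ ≤ p j / α * |q (k - j) - r k| :=
          mul_le_mul_of_nonneg_right (hw j) (abs_nonneg _)
      _ = _ := by ring
  have hl1 : l1dist (conv q (headPart p m)) (conv q (tailPart p m)) ≤ L / α := by
    have hS : HasSum (fun k => (∑' j, |p j * q (k - j) - p j * r k|) / α) (L / α) :=
      (hLs.hasSum.prod_fiberwise fun k => (hLs.prod_factor k).hasSum).div_const α
    have hS' := Summable.of_nonneg_of_le (fun k => abs_nonneg _) hpt hS.summable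
    exact hasSum_le hpt hS'.hasSum hS
  have hl0 : 0 ≤ l1dist (conv q (headPart p m)) (conv q (tailPart p m)) :=
    tsum_nonneg fun k => abs_nonneg _
  set X := l1dist (conv q (headPart p m)) (conv q (tailPart p m)) with hX
  rw [le_div_iff₀ hα₀] at hl1
  have h2 : (X * α) ^ 2 ≤ 2 * (1 * -(d * Real.log 2) - R) :=
    (pow_le_pow_left₀ (mul_nonneg hl0 hα₀.le) hl1 2).trans hP
  rw [hent, ge_iff_le]
  have e1 : α ^ 2 / (2 * Real.log 2) * X ^ 2 = (X * α) ^ 2 / (2 * Real.log 2) := by ring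
  have e2 : -(R / Real.log 2) - d =
      (2 * (1 * -(d * Real.log 2) - R)) / (2 * Real.log 2) := by field_simp; ring
  rw [e1, e2]
  exact div_le_div_of_nonneg_right h2 (by positivity)

/-- under the hypotheses of Statement 13 with finite entropies
`H(p) = c`, `H(q) = d`, one has `H(p⋆q) − d ≥ (α²/(2 ln 2))·‖q⋆p₁ − q⋆p₂‖₁²` and
`H(p⋆q) − c ≥ (β²/(2 ln 2))·‖p⋆q₁ − p⋆q₂‖₁²`. -/
theorem stmt14 (p q : ℤ → ℝ) (c d α β : ℝ) (m n : ℤ) (hp : IsPMF p) (hq : IsPMF q)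
    (hc : HasSum (fun k => -(p k * Real.logb 2 (p k))) c)
    (hd : HasSum (fun k => -(q k * Real.logb 2 (q k))) d)
    (hα₀ : 0 < α) (hα₁ : α < 1 / 2) (hβ₀ : 0 < β) (hβ₁ : β < 1 / 2)
    (hpm₁ : α ≤ headMass p m) (hpm₂ : headMass p m ≤ 1 - α)
    (hqn₁ : β ≤ headMass q n) (hqn₂ : headMass q n ≤ 1 - β) :
    entH (conv p q) - d ≥
      α ^ 2 / (2 * Real.log 2) *
        (l1dist (conv q (headPart p m)) (conv q (tailPart p m))) ^ 2 ∧
    entH (conv p q) - c ≥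
      β ^ 2 / (2 * Real.log 2) *
        (l1dist (conv p (headPart q n)) (conv p (tailPart q n))) ^ 2 := by
  refine ⟨key p q c d α m hp hq hc hd hα₀ hpm₁ hpm₂, ?_⟩
  rw [conv_comm' p q]
  exact key q p d c β n hq hp hd hc hβ₀ hqn₁ hqn₂
end

section
/- Fix c > 0 and an integer n ≥ 2. Let t_n(c) be the infimum of H(X+X' | Y,Y') − c over all pairs of independent ℤ-valued random pairs (X,Y), (X',Y') with H(X|Y) = H(X'|Y') = c in which the distributions of Y and Y' each have support of size at most n, and let t_∞(c) be the corresponding infimum with no constraint on the support sizes of Y and Y'. Then t_n(c) = t_∞(c). -/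
open MeasureTheory ProbabilityTheory

/-- Probability of an event, as a real number. -/
noncomputable def pr {Ω : Type*} [MeasurableSpace Ω] (μ : Measure Ω) (A : Set Ω) : ℝ :=
  (μ A).toReal

/-- The `(k, b)`-summand of the conditional entropy `H(X|Y)` (in bits):
`−P(X=k, Y=b)·log₂( P(X=k, Y=b) / P(Y=b) )`. -/
noncomputable def condEntTerm {Ω β : Type*} [MeasurableSpace Ω] (μ : Measure Ω)
    (X : Ω → ℤ) (Y : Ω → β) (kb : ℤ × β) : ℝ :=
  -(pr μ {ω | X ω = kb.1 ∧ Y ω = kb.2} *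
    Real.logb 2 (pr μ {ω | X ω = kb.1 ∧ Y ω = kb.2} / pr μ {ω | Y ω = kb.2}))

/-- Conditional entropy `H(X|Y)` (in bits). -/
noncomputable def condEnt {Ω β : Type*} [MeasurableSpace Ω] (μ : Measure Ω)
    (X : Ω → ℤ) (Y : Ω → β) : ℝ :=
  ∑' kb : ℤ × β, condEntTerm μ X Y kb

/-- `H(X|Y) = c` with a convergent (finite) sum. -/
def CondEntIs {Ω β : Type*} [MeasurableSpace Ω] (μ : Measure Ω)
    (X : Ω → ℤ) (Y : Ω → β) (c : ℝ) : Prop :=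
  HasSum (condEntTerm μ X Y) c

/-- The support of the distribution of a `ℤ`-valued random variable `Y`. -/
def distSupport {Ω : Type*} [MeasurableSpace Ω] (μ : Measure Ω) (Y : Ω → ℤ) : Set ℤ :=
  {i | pr μ {ω | Y ω = i} ≠ 0}

/-- The set of values `H(X+X'|Y,Y') − c` over all independent pairs `(X,Y)`, `(X',Y')` of
`ℤ`-valued random pairs with `H(X|Y) = H(X'|Y') = c` satisfying the support-size constraint
`P` on the distributions of `Y` and `Y'`. -/
def gapSet (c : ℝ) (P : Set ℤ → Prop) : Set ℝ :=
  {t | ∃ (Ω : Type) (_ : MeasurableSpace Ω) (μ : Measure Ω) (_ : IsProbabilityMeasure μ)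
    (X Y X' Y' : Ω → ℤ),
    Measurable X ∧ Measurable Y ∧ Measurable X' ∧ Measurable Y' ∧
    IndepFun (fun ω => (X ω, Y ω)) (fun ω => (X' ω, Y' ω)) μ ∧
    CondEntIs μ X Y c ∧ CondEntIs μ X' Y' c ∧
    P (distSupport μ Y) ∧ P (distSupport μ Y') ∧
    t = condEnt μ (fun ω => X ω + X' ω) (fun ω => (Y ω, Y' ω)) - c}

/-- `t_n(c)`: the infimum of `H(X+X'|Y,Y') − c` when the supports of the distributions of
`Y` and `Y'` have size at most `n`. -/
noncomputable def tN (c : ℝ) (n : ℕ) : ℝ :=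
  sInf (gapSet c (fun S => S.Finite ∧ S.ncard ≤ n))

/-- `t_∞(c)`: the infimum of `H(X+X'|Y,Y') − c` with no constraint on the support sizes. -/
noncomputable def tInf (c : ℝ) : ℝ :=
  sInf (gapSet c (fun _ => True))


open scoped ENNReal

/-- Two-point reduction for countable convex combinations in the plane. -/
theorem two_point_real (w h f : ℤ → ℝ) (C F : ℝ) (hw : ∀ i, 0 ≤ w i) (hw1 : HasSum w 1)
    (hh : HasSum (fun i => w i * h i) C) (hf : HasSum (fun i => w i * f i) F) :
    ∃ i j : ℤ, ∃ θ : ℝ, 0 < w i ∧ 0 < w j ∧ 0 ≤ θ ∧ θ ≤ 1 ∧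
      θ * h i + (1 - θ) * h j = C ∧ θ * f i + (1 - θ) * f j ≤ F := by
  by_contra hcon
  push Not at hcon
  have key : ∀ l m : ℝ, (∀ i, 0 < w i → 0 ≤ l * (f i - F) + m * (h i - C)) →
      ∀ i, 0 < w i → l * (f i - F) + m * (h i - C) = 0 := by
    intro l m hnn
    have hs : HasSum (fun i => w i * (l * (f i - F) + m * (h i - C))) 0 := by
      have h1 := ((hf.sub (hw1.mul_right F)).mul_left l).add
        ((hh.sub (hw1.mul_right C)).mul_left m)
      have e1 : (fun i => w i * (l * (f i - F) + m * (h i - C))) =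
          fun b => l * (w b * f b - w b * F) + m * (w b * h b - w b * C) := by
        funext i; ring
      have e2 : (0 : ℝ) = l * (F - 1 * F) + m * (C - 1 * C) := by ring
      rw [e1, e2]
      exact h1
    have h0 := (hasSum_zero_iff_of_nonneg (fun i => by
      rcases (hw i).eq_or_lt with h | h
      · simp [← h]
      · exact mul_nonneg h.le (hnn i h))).1 hs
    intro i hi
    have := congrFun h0 i
    simp only [Pi.zero_apply, mul_eq_zero] at this
    rcases this with h | h
    · exact absurd h hi.ne'
    · exact h
  obtain ⟨i0, hi0⟩ : ∃ i, 0 < w i := by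
    by_contra hn
    push Not at hn
    have : w = fun _ => 0 := funext fun i => le_antisymm (hn i) (hw i)
    rw [this] at hw1
    exact zero_ne_one (hasSum_zero.unique hw1)
  have heq : ∀ i, 0 < w i → h i = C → F < f i := by
    intro i hi hC
    have := hcon i i 1 hi hi zero_le_one le_rfl (by simp [hC])
    simpa using this
  have hall : ¬ ∀ i, 0 < w i → h i = C := by
    intro hC
    have := key 1 0 (fun i hi => by have := heq i hi (hC i hi); linarith) i0 hi0
    have := heq i0 hi0 (hC i0 hi0)
    linarith
  have hA : ∃ i, 0 < w i ∧ h i < C := by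
    by_contra hn
    push Not at hn
    refine hall fun i hi => ?_
    have := key 0 1 (fun i hi => by have := hn i hi; linarith) i hi
    linarith
  have hB : ∃ i, 0 < w i ∧ C < h i := by
    by_contra hn
    push Not at hn
    refine hall fun i hi => ?_
    have := key 0 (-1) (fun i hi => by have := hn i hi; linarith) i hi
    linarith
  have hchord : ∀ i j, 0 < w i → 0 < w j → h i < C → C < h j →
      (F - f i) / (C - h i) < (f j - F) / (h j - C) := by
    intro i j hi hj hiC hjC
    have hd : 0 < h j - h i := by linarith
    have := hcon i j ((h j - C) / (h j - h i)) hi hj (div_nonneg (by linarith) hd.le)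
      ((div_le_one hd).2 (by linarith)) (by field_simp; ring)
    have e : (h j - C) / (h j - h i) * f i + (1 - (h j - C) / (h j - h i)) * f j
        = ((h j - C) * f i + (C - h i) * f j) / (h j - h i) := by field_simp; ring
    rw [e, lt_div_iff₀ hd] at this
    rw [div_lt_div_iff₀ (by linarith) (by linarith)]
    nlinarith
  obtain ⟨a, haw, haC⟩ := hA
  obtain ⟨b, hbw, hbC⟩ := hB
  let S : Set ℝ := {s | ∃ i, 0 < w i ∧ h i < C ∧ s = (F - f i) / (C - h i)}
  have hSne : S.Nonempty := ⟨_, a, haw, haC, rfl⟩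
  have hSub : ∀ j, 0 < w j → C < h j → (f j - F) / (h j - C) ∈ upperBounds S := by
    rintro j hj hjC s ⟨i, hi, hiC, rfl⟩
    exact (hchord i j hi hj hiC hjC).le
  have hbdd : BddAbove S := ⟨_, hSub b hbw hbC⟩
  have hz := key 1 (-sSup S) (by
    intro i hi
    rcases lt_trichotomy (h i) C with hlt | he | hgt
    · have h1 : (F - f i) / (C - h i) ≤ sSup S := le_csSup hbdd ⟨i, hi, hlt, rfl⟩
      rw [div_le_iff₀ (by linarith)] at h1
      linarith
    · have := heq i hi he
      rw [he]; linarith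
    · have h1 : sSup S ≤ (f i - F) / (h i - C) := csSup_le hSne (hSub i hi hgt)
      rw [le_div_iff₀ (by linarith)] at h1
      linarith)
  have h1 := hz a haw
  have h2 := hz b hbw
  have h3 := hchord a b haw hbw haC hbC
  have e1 : (F - f a) / (C - h a) = sSup S := by
    rw [div_eq_iff (by linarith)]; linarith
  have e2 : (f b - F) / (h b - C) = sSup S := by
    rw [div_eq_iff (by linarith)]; linarith
  linarith

theorem two_point (w : PMF ℤ) (h f : ℤ → ℝ≥0∞) (C F : ℝ≥0∞) (hC : C ≠ ∞) (hF : F ≠ ∞)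
    (hh : ∑' i, w i * h i = C) (hf : ∑' i, w i * f i = F) :
    ∃ w2 : PMF ℤ, ∑' i, w2 i * h i = C ∧ ∑' i, w2 i * f i ≤ F ∧
      ∃ i j : ℤ, {l | w2 l ≠ 0} ⊆ {i, j} := by
  have conv1 : ∀ (g : ℤ → ℝ≥0∞) (G : ℝ≥0∞), G ≠ ∞ → ∑' i, w i * g i = G →
      HasSum (fun i => (w i).toReal * (g i).toReal) G.toReal := by
    intro g G hG hg
    have := ENNReal.hasSum_toReal (f := fun i => w i * g i) (by rw [hg]; exact hG)
    rw [← ENNReal.tsum_toReal_eq (f := fun i => w i * g i)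
      (fun i => ENNReal.ne_top_of_tsum_ne_top (by rw [hg]; exact hG) i), hg] at this
    simpa [ENNReal.toReal_mul] using this
  have hw1 : HasSum (fun i => (w i).toReal) 1 := by
    have := conv1 (fun _ => 1) 1 (by simp) (by simp [w.tsum_coe])
    simpa using this
  have fin : ∀ (g : ℤ → ℝ≥0∞) (G : ℝ≥0∞), G ≠ ∞ → ∑' i, w i * g i = G → ∀ i,
      0 < (w i).toReal → g i ≠ ∞ := by
    intro g G hG hg i hi hi'
    have h1 := ENNReal.ne_top_of_tsum_ne_top (by rw [hg]; exact hG) i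
    rw [hi', ENNReal.mul_top] at h1
    · exact h1 rfl
    · intro h0; simp [h0] at hi
  obtain ⟨i, j, θ, hi, hj, h0, h1, e1, e2⟩ := two_point_real (fun i => (w i).toReal)
    (fun i => (h i).toReal) (fun i => (f i).toReal) C.toReal F.toReal
    (fun _ => ENNReal.toReal_nonneg) hw1 (conv1 h C hC hh) (conv1 f F hF hf)
  have tot : ∀ g : ℤ → ℝ≥0∞,
      ∑' l, (ENNReal.ofReal θ * PMF.pure i l + ENNReal.ofReal (1 - θ) * PMF.pure j l) * g l
        = ENNReal.ofReal θ * g i + ENNReal.ofReal (1 - θ) * g j := by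
    intro g
    simp_rw [add_mul]
    rw [ENNReal.tsum_add, tsum_eq_single i, tsum_eq_single j]
    · simp
    · intro b hb; simp [hb]
    · intro b hb; simp [hb]
  have tot' : ∀ g : ℤ → ℝ≥0∞, g i ≠ ∞ → g j ≠ ∞ →
      ENNReal.ofReal θ * g i + ENNReal.ofReal (1 - θ) * g j =
      ENNReal.ofReal (θ * (g i).toReal + (1 - θ) * (g j).toReal) := by
    intro g gi gj
    rw [ENNReal.ofReal_add, ENNReal.ofReal_mul h0, ENNReal.ofReal_mul (by linarith),
      ENNReal.ofReal_toReal gi, ENNReal.ofReal_toReal gj]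
    · positivity
    · exact mul_nonneg (by linarith) ENNReal.toReal_nonneg
  refine ⟨⟨fun l => ENNReal.ofReal θ * PMF.pure i l + ENNReal.ofReal (1 - θ) * PMF.pure j l, ?_⟩,
    ?_, ?_, i, j, ?_⟩
  · have := tot (fun _ => 1)
    simp only [mul_one] at this
    rw [← ENNReal.ofReal_add h0 (by linarith)] at this
    simp only [add_sub_cancel, ENNReal.ofReal_one] at this
    rw [← this]
    exact ENNReal.summable.hasSum
  · refine (tot h).trans ?_
    rw [tot' h (fin h C hC hh i hi) (fin h C hC hh j hj), e1, ENNReal.ofReal_toReal hC]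
  · refine (tot f).le.trans ?_
    rw [tot' f (fin f F hF hf i hi) (fin f F hF hf j hj), ← ENNReal.ofReal_toReal hF]
    exact ENNReal.ofReal_le_ofReal e2
  · intro l hl
    by_contra hn
    simp only [Set.mem_insert_iff, Set.mem_singleton_iff, not_or] at hn
    apply hl
    change ENNReal.ofReal θ * PMF.pure i l + ENNReal.ofReal (1 - θ) * PMF.pure j l = 0
    simp [hn.1, hn.2]

/-- `-log₂ x` as an extended nonnegative real. -/
noncomputable def LE2 (x : ℝ≥0∞) : ℝ≥0∞ := ENNReal.ofReal (-Real.logb 2 x.toReal)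

/-- Entropy of a law on `ℤ`. -/
noncomputable def HE (q : PMF ℤ) : ℝ≥0∞ := ∑' k, q k * LE2 (q k)

/-- Law of the sum of independent variables. -/
noncomputable def cv (p q : PMF ℤ) : PMF ℤ :=
  ⟨fun m => ∑' k, p k * q (m - k), by
    have : ∑' m, ∑' k, p k * q (m - k) = 1 := by
      rw [ENNReal.tsum_comm]
      have h : ∀ k, ∑' m, q (m - k) = 1 := fun k =>
        ((Equiv.subRight k).tsum_eq (fun m => q m)).trans q.tsum_coe
      simp_rw [ENNReal.tsum_mul_left, h, mul_one, p.tsum_coe]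
    rw [← this]
    exact ENNReal.summable.hasSum⟩

theorem cv_apply (p q : PMF ℤ) (m : ℤ) : cv p q m = ∑' k, p k * q (m - k) := rfl

theorem LE2_anti {x y : ℝ≥0∞} (hx : x ≠ 0) (hxy : x ≤ y) (hy : y ≠ ∞) : LE2 y ≤ LE2 x := by
  unfold LE2
  apply ENNReal.ofReal_le_ofReal
  apply neg_le_neg
  exact Real.logb_le_logb_of_le (by norm_num)
    (ENNReal.toReal_pos hx (ne_top_of_le_ne_top hy hxy)) (ENNReal.toReal_mono hy hxy)

theorem LE2_mul {x y : ℝ≥0∞} (hx : x ≠ 0) (hx' : x ≠ ∞) (hy : y ≠ 0) (hy' : y ≠ ∞) :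
    LE2 (x * y) ≤ LE2 x + LE2 y := by
  unfold LE2
  rw [ENNReal.toReal_mul, Real.logb_mul (ENNReal.toReal_pos hx hx').ne'
    (ENNReal.toReal_pos hy hy').ne', neg_add]
  exact ENNReal.ofReal_add_le

theorem HE_cv_le (p q : PMF ℤ) : HE (cv p q) ≤ HE p + HE q := by
  have hs : ∀ k, ∀ g : ℤ → ℝ≥0∞, ∑' m, g (m - k) = ∑' m, g m := fun k g =>
    (Equiv.subRight k).tsum_eq g
  calc HE (cv p q) = ∑' m, ∑' k, p k * q (m - k) * LE2 (cv p q m) := by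
        unfold HE
        refine tsum_congr fun m => ?_
        rw [ENNReal.tsum_mul_right, ← cv_apply]
    _ ≤ ∑' m, ∑' k, p k * q (m - k) * (LE2 (p k) + LE2 (q (m - k))) := by
        refine ENNReal.tsum_le_tsum fun m => ENNReal.tsum_le_tsum fun k => ?_
        by_cases h1 : p k = 0
        · simp [h1]
        by_cases h2 : q (m - k) = 0
        · simp [h2]
        gcongr
        refine (LE2_anti (mul_ne_zero h1 h2) ?_ ((cv p q).apply_ne_top m)).trans
          (LE2_mul h1 (p.apply_ne_top k) h2 (q.apply_ne_top _))
        exact ENNReal.le_tsum (f := fun k => p k * q (m - k)) k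
    _ = ∑' k, ∑' m, p k * q m * (LE2 (p k) + LE2 (q m)) := by
        rw [ENNReal.tsum_comm]
        exact tsum_congr fun k => hs k (fun m => p k * q m * (LE2 (p k) + LE2 (q m)))
    _ = ∑' k, (p k * LE2 (p k) + p k * HE q) := by
        refine tsum_congr fun k => ?_
        have : ∀ m, p k * q m * (LE2 (p k) + LE2 (q m))
          = p k * LE2 (p k) * q m + p k * (q m * LE2 (q m)) := fun m => by ring
        simp_rw [this]
        rw [ENNReal.tsum_add, ENNReal.tsum_mul_left, ENNReal.tsum_mul_left, q.tsum_coe, mul_one]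
        rfl
    _ = HE p + HE q := by
        rw [ENNReal.tsum_add, ENNReal.tsum_mul_right, p.tsum_coe, one_mul]
        rfl

section general
variable {Ω β : Type*} [MeasurableSpace Ω] [Countable β] [MeasurableSpace β]
  [MeasurableSingletonClass β] (μ : Measure Ω) (X : Ω → ℤ) (Y : Ω → β)

theorem marg (hX : Measurable X) (hY : Measurable Y) (W : β → ℝ≥0∞) (Q : β → PMF ℤ)
    (hWQ : ∀ k b, μ {ω | X ω = k ∧ Y ω = b} = W b * Q b k) (b : β) :
    μ {ω | Y ω = b} = W b := by
  have h1 : {ω | Y ω = b} = ⋃ k : ℤ, {ω | X ω = k ∧ Y ω = b} := by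
    ext ω; simp
  rw [h1, measure_iUnion]
  · simp_rw [hWQ, ENNReal.tsum_mul_left, (Q b).tsum_coe, mul_one]
  · intro k l hkl
    refine Set.disjoint_left.2 ?_
    rintro ω ⟨h, -⟩ ⟨h', -⟩
    exact hkl (h.symm.trans h')
  · intro k
    exact (hX (measurableSet_singleton k)).inter (hY (measurableSet_singleton b))

theorem term_eq (hX : Measurable X) (hY : Measurable Y) (W : β → ℝ≥0∞) (Q : β → PMF ℤ)
    (hW : ∀ b, W b ≠ ∞)
    (hWQ : ∀ k b, μ {ω | X ω = k ∧ Y ω = b} = W b * Q b k) (kb : ℤ × β) :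
    condEntTerm μ X Y kb = (W kb.2 * (Q kb.2 kb.1 * LE2 (Q kb.2 kb.1))).toReal := by
  obtain ⟨k, b⟩ := kb
  unfold condEntTerm pr
  rw [hWQ, marg μ X Y hX hY W Q hWQ]
  simp only [ENNReal.toReal_mul, LE2]
  rw [ENNReal.toReal_ofReal]
  · by_cases h : (W b).toReal = 0
    · simp [h]
    · rw [mul_div_cancel_left₀ _ h]; ring
  · rw [neg_nonneg]
    refine Real.logb_nonpos (by norm_num) ENNReal.toReal_nonneg ?_
    exact ENNReal.toReal_le_of_le_ofReal zero_le_one (by simpa using (Q b).coe_le_one k)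

theorem total_eq (W : β → ℝ≥0∞) (Q : β → PMF ℤ) :
    ∑' kb : ℤ × β, W kb.2 * (Q kb.2 kb.1 * LE2 (Q kb.2 kb.1)) = ∑' b, W b * HE (Q b) := by
  rw [ENNReal.tsum_prod', ENNReal.tsum_comm]
  simp_rw [ENNReal.tsum_mul_left]
  rfl

theorem term_ne_top (W : β → ℝ≥0∞) (Q : β → PMF ℤ)
    (hW : ∀ b, W b ≠ ∞) (kb : ℤ × β) : W kb.2 * (Q kb.2 kb.1 * LE2 (Q kb.2 kb.1)) ≠ ∞ :=
  ENNReal.mul_ne_top (hW _) (ENNReal.mul_ne_top ((Q _).apply_ne_top _) ENNReal.ofReal_ne_top)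

theorem condEnt_eq (hX : Measurable X) (hY : Measurable Y) (W : β → ℝ≥0∞) (Q : β → PMF ℤ)
    (hW : ∀ b, W b ≠ ∞)
    (hWQ : ∀ k b, μ {ω | X ω = k ∧ Y ω = b} = W b * Q b k) :
    condEnt μ X Y = (∑' b, W b * HE (Q b)).toReal := by
  unfold condEnt
  simp_rw [term_eq μ X Y hX hY W Q hW hWQ]
  rw [← ENNReal.tsum_toReal_eq (term_ne_top W Q hW), total_eq]

theorem condEntIs_iff (hX : Measurable X) (hY : Measurable Y) (W : β → ℝ≥0∞) (Q : β → PMF ℤ)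
    (hW : ∀ b, W b ≠ ∞)
    (hWQ : ∀ k b, μ {ω | X ω = k ∧ Y ω = b} = W b * Q b k) (c : ℝ) (hc : 0 < c) :
    CondEntIs μ X Y c ↔ ∑' b, W b * HE (Q b) = ENNReal.ofReal c := by
  unfold CondEntIs
  have h1 : condEntTerm μ X Y =
    fun kb => (W kb.2 * (Q kb.2 kb.1 * LE2 (Q kb.2 kb.1))).toReal :=
    funext (term_eq μ X Y hX hY W Q hW hWQ)
  rw [h1, ← total_eq]
  constructor
  · intro h
    have h2 := ENNReal.ofReal_tsum_of_nonneg (fun _ => ENNReal.toReal_nonneg) h.summable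
    rw [h.tsum_eq] at h2
    rw [h2]
    exact tsum_congr fun kb => (ENNReal.ofReal_toReal (term_ne_top W Q hW kb)).symm
  · intro h
    have h2 := ENNReal.hasSum_toReal (by rw [h]; exact ENNReal.ofReal_ne_top)
    rw [← ENNReal.tsum_toReal_eq (term_ne_top W Q hW), h, ENNReal.toReal_ofReal hc.le] at h2
    exact h2

end general

/-- The value `H(X+X'|Y,Y')` as a function of the laws. -/
noncomputable def V (w : PMF ℤ) (p : ℤ → PMF ℤ) (w' : PMF ℤ) (p' : ℤ → PMF ℤ) : ℝ≥0∞ :=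
  ∑' i, w i * ∑' j, w' j * HE (cv (p i) (p' j))

theorem V_swap (w : PMF ℤ) (p : ℤ → PMF ℤ) (w' : PMF ℤ) (p' : ℤ → PMF ℤ) :
    V w p w' p' = ∑' j, w' j * ∑' i, w i * HE (cv (p i) (p' j)) := by
  unfold V
  simp_rw [← ENNReal.tsum_mul_left]
  rw [ENNReal.tsum_comm]
  refine tsum_congr fun j => tsum_congr fun i => ?_
  ring

theorem V_le (w : PMF ℤ) (p : ℤ → PMF ℤ) (w' : PMF ℤ) (p' : ℤ → PMF ℤ) :
    V w p w' p' ≤ ∑' i, w i * HE (p i) + ∑' j, w' j * HE (p' j) := by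
  calc V w p w' p' ≤ ∑' i, w i * ∑' j, w' j * (HE (p i) + HE (p' j)) := by
        unfold V
        gcongr with i j
        exact HE_cv_le _ _
    _ = _ := by
        simp_rw [mul_add, ENNReal.tsum_add, ENNReal.tsum_mul_right, w'.tsum_coe, one_mul, mul_add,
          ENNReal.tsum_add, ENNReal.tsum_mul_right, w.tsum_coe, one_mul]

theorem condEnt_sum {Ω : Type*} [MeasurableSpace Ω] (μ : Measure Ω)
    (X Y X' Y' : Ω → ℤ) (hX : Measurable X) (hY : Measurable Y) (hX' : Measurable X')
    (hY' : Measurable Y') (hI : IndepFun (fun ω => (X ω, Y ω)) (fun ω => (X' ω, Y' ω)) μ)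
    (w : PMF ℤ) (p : ℤ → PMF ℤ) (w' : PMF ℤ) (p' : ℤ → PMF ℤ)
    (h1 : ∀ k b, μ {ω | X ω = k ∧ Y ω = b} = w b * p b k)
    (h2 : ∀ k b, μ {ω | X' ω = k ∧ Y' ω = b} = w' b * p' b k) :
    condEnt μ (fun ω => X ω + X' ω) (fun ω => (Y ω, Y' ω)) = (V w p w' p').toReal := by
  rw [condEnt_eq μ (fun ω => X ω + X' ω) (fun ω => (Y ω, Y' ω)) (hX.add hX') (hY.prodMk hY')
    (fun b => w b.1 * w' b.2) (fun b => cv (p b.1) (p' b.2))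
    (fun b => ENNReal.mul_ne_top (w.apply_ne_top _) (w'.apply_ne_top _))]
  · congr 1
    rw [ENNReal.tsum_prod']
    unfold V
    simp_rw [mul_assoc, ENNReal.tsum_mul_left]
  · rintro m ⟨i, j⟩
    have hu : {ω | X ω + X' ω = m ∧ (Y ω, Y' ω) = (i, j)} =
        ⋃ k : ℤ, ((fun ω => (X ω, Y ω)) ⁻¹' {(k, i)} ∩ (fun ω => (X' ω, Y' ω)) ⁻¹' {(m - k, j)}) := by
      ext ω
      simp only [Set.mem_setOf_eq, Prod.mk.injEq, Set.mem_iUnion, Set.mem_inter_iff,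
        Set.mem_preimage, Set.mem_singleton_iff]
      constructor
      · rintro ⟨a, b, c⟩
        exact ⟨X ω, ⟨rfl, b⟩, by omega, c⟩
      · rintro ⟨k, ⟨a, b⟩, c, d⟩
        exact ⟨by omega, b, d⟩
    rw [hu, measure_iUnion]
    · have e : ∀ k, μ ((fun ω => (X ω, Y ω)) ⁻¹' {(k, i)} ∩
          (fun ω => (X' ω, Y' ω)) ⁻¹' {(m - k, j)})
          = w i * w' j * (p i k * p' j (m - k)) := by
        intro k
        rw [hI.measure_inter_preimage_eq_mul _ _ (measurableSet_singleton _)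
          (measurableSet_singleton _)]
        have e1 : (fun ω => (X ω, Y ω)) ⁻¹' {(k, i)} = {ω | X ω = k ∧ Y ω = i} := by
          ext ω; simp
        have e2 : (fun ω => (X' ω, Y' ω)) ⁻¹' {(m - k, j)} = {ω | X' ω = m - k ∧ Y' ω = j} := by
          ext ω; simp
        rw [e1, e2, h1, h2]
        ring
      simp_rw [e, ENNReal.tsum_mul_left]
      rfl
    · intro k l hkl
      refine Set.disjoint_left.2 ?_
      rintro ω ⟨h, -⟩ ⟨h', -⟩
      simp only [Set.mem_preimage, Set.mem_singleton_iff, Prod.mk.injEq] at h h'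
      exact hkl (h.1.symm.trans h'.1)
    · intro k
      exact ((hX.prodMk hY) (measurableSet_singleton _)).inter
        ((hX'.prodMk hY') (measurableSet_singleton _))

/-- Disintegration of the law of a pair. -/
theorem disint {Ω : Type*} [MeasurableSpace Ω] (μ : Measure Ω) [IsProbabilityMeasure μ]
    (X Y : Ω → ℤ) (hX : Measurable X) (hY : Measurable Y) :
    ∃ (w : PMF ℤ) (p : ℤ → PMF ℤ), ∀ k b, μ {ω | X ω = k ∧ Y ω = b} = w b * p b k := by
  have hm : ∀ b, ∑' k, μ {ω | X ω = k ∧ Y ω = b} = μ {ω | Y ω = b} := by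
    intro b
    have h1 : {ω | Y ω = b} = ⋃ k : ℤ, {ω | X ω = k ∧ Y ω = b} := by
      ext ω; simp
    rw [h1, measure_iUnion]
    · intro k l hkl
      refine Set.disjoint_left.2 ?_
      rintro ω ⟨h, -⟩ ⟨h', -⟩
      exact hkl (h.symm.trans h')
    · intro k
      exact (hX (measurableSet_singleton k)).inter (hY (measurableSet_singleton b))
  have hw : ∑' b, μ {ω | Y ω = b} = 1 := by
    have h1 : (Set.univ : Set Ω) = ⋃ b : ℤ, {ω | Y ω = b} := by
      ext ω; simp
    rw [← measure_univ (μ := μ), h1, measure_iUnion]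
    · intro k l hkl
      refine Set.disjoint_left.2 ?_
      intro ω h h'
      exact hkl (h.symm.trans h')
    · intro k
      exact hY (measurableSet_singleton k)
  have hp : ∀ b, ∃ q : PMF ℤ, ∀ k, μ {ω | X ω = k ∧ Y ω = b} = μ {ω | Y ω = b} * q k := by
    intro b
    by_cases h0 : μ {ω | Y ω = b} = 0
    · refine ⟨PMF.pure 0, fun k => ?_⟩
      rw [h0, zero_mul]
      exact measure_mono_null (fun ω h => h.2) h0
    · have ht : μ {ω | Y ω = b} ≠ ∞ := measure_ne_top _ _
      refine ⟨⟨fun k => (μ {ω | Y ω = b})⁻¹ * μ {ω | X ω = k ∧ Y ω = b}, ?_⟩, fun k => ?_⟩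
      · have : ∑' k, (μ {ω | Y ω = b})⁻¹ * μ {ω | X ω = k ∧ Y ω = b} = 1 := by
          rw [ENNReal.tsum_mul_left, hm, ENNReal.inv_mul_cancel h0 ht]
        rw [← this]
        exact ENNReal.summable.hasSum
      · change _ = _ * ((μ {ω | Y ω = b})⁻¹ * μ {ω | X ω = k ∧ Y ω = b})
        rw [← mul_assoc, ENNReal.mul_inv_cancel h0 ht, one_mul]
  choose p hp using hp
  refine ⟨⟨fun b => μ {ω | Y ω = b}, ?_⟩, p, fun k b => hp b k⟩
  rw [← hw]
  exact ENNReal.summable.hasSum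

/-- The joint law with marginal `w` and conditional laws `p`. -/
noncomputable def joint (w : PMF ℤ) (p : ℤ → PMF ℤ) : PMF (ℤ × ℤ) :=
  ⟨fun z => w z.2 * p z.2 z.1, by
    have : ∑' z : ℤ × ℤ, w z.2 * p z.2 z.1 = 1 := by
      rw [ENNReal.tsum_prod', ENNReal.tsum_comm]
      simp_rw [ENNReal.tsum_mul_left, PMF.tsum_coe, mul_one, PMF.tsum_coe]
    rw [← this]
    exact ENNReal.summable.hasSum⟩

theorem joint_meas (w : PMF ℤ) (p : ℤ → PMF ℤ) (k b : ℤ) :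
    (joint w p).toMeasure {z | z.1 = k ∧ z.2 = b} = w b * p b k := by
  have : {z : ℤ × ℤ | z.1 = k ∧ z.2 = b} = {(k, b)} := by
    ext z; simp [Prod.ext_iff]
  rw [this, PMF.toMeasure_apply_singleton _ _ (measurableSet_singleton _)]
  rfl

theorem realize (c : ℝ) (hc : 0 < c) (P : Set ℤ → Prop) (w : PMF ℤ) (p : ℤ → PMF ℤ) (w' : PMF ℤ)
    (p' : ℤ → PMF ℤ) (h : ∑' i, w i * HE (p i) = ENNReal.ofReal c)
    (h' : ∑' i, w' i * HE (p' i) = ENNReal.ofReal c)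
    (hP : P {i | w i ≠ 0}) (hP' : P {i | w' i ≠ 0}) :
    (V w p w' p').toReal - c ∈ gapSet c P := by
  let μ := (joint w p).toMeasure.prod (joint w' p').toMeasure
  have mX : Measurable (fun z : (ℤ × ℤ) × (ℤ × ℤ) => z.1.1) := by fun_prop
  have mY : Measurable (fun z : (ℤ × ℤ) × (ℤ × ℤ) => z.1.2) := by fun_prop
  have mX' : Measurable (fun z : (ℤ × ℤ) × (ℤ × ℤ) => z.2.1) := by fun_prop
  have mY' : Measurable (fun z : (ℤ × ℤ) × (ℤ × ℤ) => z.2.2) := by fun_prop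
  have e1 : ∀ k b, μ {z | z.1.1 = k ∧ z.1.2 = b} = w b * p b k := by
    intro k b
    have : {z : (ℤ × ℤ) × (ℤ × ℤ) | z.1.1 = k ∧ z.1.2 = b} =
      {z : ℤ × ℤ | z.1 = k ∧ z.2 = b} ×ˢ Set.univ := by ext z; simp
    rw [this, Measure.prod_prod, joint_meas, measure_univ, mul_one]
  have e2 : ∀ k b, μ {z | z.2.1 = k ∧ z.2.2 = b} = w' b * p' b k := by
    intro k b
    have : {z : (ℤ × ℤ) × (ℤ × ℤ) | z.2.1 = k ∧ z.2.2 = b} =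
      Set.univ ×ˢ {z : ℤ × ℤ | z.1 = k ∧ z.2 = b} := by ext z; simp
    rw [this, Measure.prod_prod, joint_meas, measure_univ, one_mul]
  have hI : IndepFun (fun z : (ℤ × ℤ) × (ℤ × ℤ) => (z.1.1, z.1.2)) (fun z => (z.2.1, z.2.2)) μ :=
    indepFun_prod (X := fun z : ℤ × ℤ => z) (Y := fun z : ℤ × ℤ => z) measurable_id measurable_id
  have supp : ∀ (Y : (ℤ × ℤ) × (ℤ × ℤ) → ℤ) (v : PMF ℤ), (∀ b, μ {z | Y z = b} = v b) →
      distSupport μ Y = {i | v i ≠ 0} := by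
    intro Y v hv
    ext i
    simp [distSupport, pr, hv, ENNReal.toReal_eq_zero_iff, v.apply_ne_top]
  refine ⟨(ℤ × ℤ) × (ℤ × ℤ), inferInstance, μ, inferInstance, fun z => z.1.1, fun z => z.1.2,
    fun z => z.2.1, fun z => z.2.2, mX, mY, mX', mY', hI, ?_, ?_, ?_, ?_, ?_⟩
  · exact (condEntIs_iff μ _ _ mX mY w p w.apply_ne_top e1 c hc).2 h
  · exact (condEntIs_iff μ _ _ mX' mY' w' p' w'.apply_ne_top e2 c hc).2 h'
  · rwa [supp _ w (marg μ _ _ mX mY w p e1)]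
  · rwa [supp _ w' (marg μ _ _ mX' mY' w' p' e2)]
  · rw [condEnt_sum μ _ _ _ _ mX mY mX' mY' hI w p w' p' e1 e2]

theorem reduce (c : ℝ) (hc : 0 < c) (n : ℕ) (hn : 2 ≤ n) (t : ℝ)
    (ht : t ∈ gapSet c (fun _ => True)) :
    -c ≤ t ∧ ∃ s ∈ gapSet c (fun S => S.Finite ∧ S.ncard ≤ n), s ≤ t := by
  obtain ⟨Ω, _, μ, _, X, Y, X', Y', hX, hY, hX', hY', hI, hE, hE', -, -, rfl⟩ := ht
  obtain ⟨w, p, h1⟩ := disint μ X Y hX hY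
  obtain ⟨w', p', h2⟩ := disint μ X' Y' hX' hY'
  rw [condEnt_sum μ X Y X' Y' hX hY hX' hY' hI w p w' p' h1 h2]
  rw [condEntIs_iff μ X Y hX hY w p w.apply_ne_top h1 c hc] at hE
  rw [condEntIs_iff μ X' Y' hX' hY' w' p' w'.apply_ne_top h2 c hc] at hE'
  have hV : V w p w' p' ≠ ∞ := by
    refine ne_top_of_le_ne_top ?_ (V_le w p w' p')
    rw [hE, hE']
    exact ENNReal.add_ne_top.2 ⟨ENNReal.ofReal_ne_top, ENNReal.ofReal_ne_top⟩
  refine ⟨by have := ENNReal.toReal_nonneg (a := V w p w' p'); linarith, ?_⟩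
  obtain ⟨w2, a1, a2, i, j, a3⟩ := two_point w _ _ _ _ ENNReal.ofReal_ne_top hV hE
    (show ∑' i, w i * ∑' j, w' j * HE (cv (p i) (p' j)) = V w p w' p' from rfl)
  have a2' : V w2 p w' p' ≤ V w p w' p' := a2
  obtain ⟨w2', b1, b2, i', j', b3⟩ := two_point w' _ _ _ _ ENNReal.ofReal_ne_top
    (ne_top_of_le_ne_top hV a2') hE' (V_swap w2 p w' p').symm
  have b2' : V w2 p w2' p' ≤ V w2 p w' p' := (V_swap w2 p w2' p').le.trans b2
  have two : ∀ (S : Set ℤ) (i j : ℤ), S ⊆ {i, j} → S.Finite ∧ S.ncard ≤ n := by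
    intro S i j hS
    have hf : ({i, j} : Set ℤ).Finite := Set.toFinite _
    exact ⟨hf.subset hS, (Set.ncard_le_ncard hS hf).trans (le_trans (by
      have := Set.ncard_insert_le i {j}
      rwa [Set.ncard_singleton] at this) hn)⟩
  refine ⟨_, realize c hc _ w2 p w2' p' a1 b1 (two _ i j a3) (two _ i' j' b3), ?_⟩
  have := ENNReal.toReal_mono hV (b2'.trans a2')
  linarith

/-- for every `c > 0` and every `n ≥ 2`, `t_n(c) = t_∞(c)`. -/
theorem stmt16 (c : ℝ) (hc : 0 < c) (n : ℕ) (hn : 2 ≤ n) : tN c n = tInf c := by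
  unfold tN tInf
  have hsub : gapSet c (fun S => S.Finite ∧ S.ncard ≤ n) ⊆ gapSet c (fun _ => True) := by
    rintro t ⟨Ω, m, μ, hμ, X, Y, X', Y', a, b, c', d, e, f, g, -, -, h⟩
    exact ⟨Ω, m, μ, hμ, X, Y, X', Y', a, b, c', d, e, f, g, trivial, trivial, h⟩
  have hb : BddBelow (gapSet c (fun _ => True)) :=
    ⟨-c, fun t ht => (reduce c hc n hn t ht).1⟩
  rcases (gapSet c (fun _ => True)).eq_empty_or_nonempty with h0 | ⟨t, ht⟩
  · have h1 := hsub
    rw [h0, Set.subset_empty_iff] at h1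
    rw [h0, h1]
  · obtain ⟨s, hs, -⟩ := (reduce c hc n hn t ht).2
    apply le_antisymm
    · refine le_csInf ⟨t, ht⟩ fun u hu => ?_
      obtain ⟨v, hv, hvu⟩ := (reduce c hc n hn u hu).2
      exact (csInf_le (hb.mono hsub) hv).trans hvu
    · exact csInf_le_csInf hb ⟨s, hs⟩ hsub
end
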